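/- Every cubic graph g on 2n vertices can be transformed by at most girth(g) − 1 Whitehead moves into a cubic graph containing a loop (and hence, if it has more than two vertices, into a bridged graph), where girth(g) is the length of a shortest cycle of g. -/

import Mathlib

/-! Cubic multigraphs in the dart (half-edge) model, Whitehead moves,
and the "graph of graphs" `Γ_n`. -/

/-- A cubic multigraph on the `2 * n` vertices `Fin (2 * n)`, in the dart (half-edge) model:
darts are `Fin (6 * n)`, `dinv` is the fixed-point-free involution exchanging the two darts of
each edge, and `vert` assigns to each dart its base vertex.  Loops and multiple edges are
allowed; `regular` says every vertex carries exactly three darts. -/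
structure CubicGraph (n : ℕ) where
  vert : Fin (6 * n) → Fin (2 * n)
  dinv : Fin (6 * n) → Fin (6 * n)
  dinv_invol : ∀ d, dinv (dinv d) = d
  dinv_ne : ∀ d, dinv d ≠ d
  regular : ∀ v : Fin (2 * n), (Finset.univ.filter fun d => vert d = v).card = 3

namespace CubicGraph

variable {n : ℕ}

/-- Two darts are joined if they can be connected by a chain of
"same vertex" / "other half of the same edge" steps. -/
def Reach (g : CubicGraph n) : Fin (6 * n) → Fin (6 * n) → Prop :=
  Relation.ReflTransGen fun a b => g.vert a = g.vert b ∨ g.dinv a = b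

/-- Connectivity of a cubic multigraph. -/
def Connected (g : CubicGraph n) : Prop := ∀ d d', g.Reach d d'

/-- The edge of the dart `d` is a loop. -/
def IsLoop (g : CubicGraph n) (d : Fin (6 * n)) : Prop := g.vert (g.dinv d) = g.vert d

instance (g : CubicGraph n) (d : Fin (6 * n)) : Decidable (g.IsLoop d) :=
  inferInstanceAs (Decidable (_ = _))

lemma card_filter_comp_swap (g : CubicGraph n) (q r : Fin (6 * n)) (v : Fin (2 * n)) :
    (Finset.univ.filter fun d => g.vert (Equiv.swap q r d) = v).card
      = (Finset.univ.filter fun d => g.vert d = v).card := by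
  refine Finset.card_bij (fun d _ => Equiv.swap q r d) ?_ ?_ ?_
  · intro a ha
    simp only [Finset.mem_filter, Finset.mem_univ, true_and] at ha ⊢
    exact ha
  · intro a _ b _ h
    exact (Equiv.swap q r).injective h
  · intro b hb
    simp only [Finset.mem_filter, Finset.mem_univ, true_and] at hb
    exact ⟨Equiv.swap q r b, by simp [hb], by simp⟩

/-- Exchange the base vertices of the two darts `q` and `r`, keeping everything else. -/
def swapDarts (g : CubicGraph n) (q r : Fin (6 * n)) : CubicGraph n where
  vert := fun d => g.vert (Equiv.swap q r d)
  dinv := g.dinv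
  dinv_invol := g.dinv_invol
  dinv_ne := g.dinv_ne
  regular := fun v => (g.card_filter_comp_swap q r v).trans (g.regular v)

/-- The darts based at the same vertex as `x`, other than `x` itself. -/
def othersAt (g : CubicGraph n) (x : Fin (6 * n)) : Finset (Fin (6 * n)) :=
  (Finset.univ.filter fun d => g.vert d = g.vert x).erase x

lemma othersAt_nonempty (g : CubicGraph n) (x : Fin (6 * n)) :
    (g.othersAt x).Nonempty := by
  have hx : x ∈ Finset.univ.filter fun d => g.vert d = g.vert x := by simp
  have h : (g.othersAt x).card = 2 := by
    rw [othersAt, Finset.card_erase_of_mem hx, g.regular]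
  rw [← Finset.card_pos, h]
  norm_num

def oMin (g : CubicGraph n) (x : Fin (6 * n)) : Fin (6 * n) :=
  (g.othersAt x).min' (g.othersAt_nonempty x)

def oMax (g : CubicGraph n) (x : Fin (6 * n)) : Fin (6 * n) :=
  (g.othersAt x).max' (g.othersAt_nonempty x)

/-- The two Whitehead moves (indexed by `i : Fin 2`) performed on the edge containing the dart
`x`.  On a loop the move leaves the graph unchanged; on a non-loop edge the two darts at the
endpoints of the edge other than the edge's own darts are re-attached in one of the two
possible new ways (realized by transporting one dart from each endpoint to the other). -/
def wh (g : CubicGraph n) (i : Fin 2) (x : Fin (6 * n)) : CubicGraph n :=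
  if g.IsLoop x then g
  else if i = 0 then g.swapDarts (g.oMax x) (g.oMin (g.dinv x))
  else g.swapDarts (g.oMax x) (g.oMax (g.dinv x))

/-- An isomorphism of cubic multigraphs: a bijection of darts together with a compatible
bijection of vertices, commuting with the edge involutions. -/
structure Iso (g₁ g₂ : CubicGraph n) where
  dartEquiv : Fin (6 * n) ≃ Fin (6 * n)
  vertEquiv : Fin (2 * n) ≃ Fin (2 * n)
  map_dinv : ∀ d, g₂.dinv (dartEquiv d) = dartEquiv (g₁.dinv d)
  map_vert : ∀ d, g₂.vert (dartEquiv d) = vertEquiv (g₁.vert d)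

def IsIsomorphic (g₁ g₂ : CubicGraph n) : Prop := Nonempty (Iso g₁ g₂)

/-- Reachability avoiding the edge of the dart `x` (i.e. in the graph with that edge removed). -/
def ReachAvoiding (g : CubicGraph n) (x : Fin (6 * n)) :
    Fin (6 * n) → Fin (6 * n) → Prop :=
  Relation.ReflTransGen fun a b =>
    g.vert a = g.vert b ∨ (g.dinv a = b ∧ a ≠ x ∧ a ≠ g.dinv x)

/-- The edge of `x` is a bridge: removing it disconnects the graph. -/
def IsBridge (g : CubicGraph n) (x : Fin (6 * n)) : Prop :=
  ¬ ∀ d d', g.ReachAvoiding x d d'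

/-- A (connected) graph is bridged if it has at least one bridge. -/
def Bridged (g : CubicGraph n) : Prop := ∃ x, g.IsBridge x

/-- A graph is bridgeless if it has no bridge. -/
def Bridgeless (g : CubicGraph n) : Prop := ∀ x, ¬ g.IsBridge x

/-- `c` lists consecutive darts of a cycle of length `k`: the vertices visited are pairwise
distinct, the end of each dart's edge is the base of the next one (cyclically), and the `k`
edges used are pairwise distinct. -/
def IsCycle (g : CubicGraph n) (k : ℕ) (c : Fin k → Fin (6 * n)) : Prop :=
  (∀ i : Fin k,
    g.vert (g.dinv (c i)) = g.vert (c ⟨(i.1 + 1) % k, Nat.mod_lt _ i.pos⟩)) ∧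
  Function.Injective (fun i => g.vert (c i)) ∧
  ∀ i j : Fin k, c j ≠ g.dinv (c i)

/-- The cycle `c` is indecomposable (induced): no edge of `g` other than the cycle's own
edges joins two vertices of the cycle. -/
def Indecomposable (g : CubicGraph n) (k : ℕ) (c : Fin k → Fin (6 * n)) : Prop :=
  ∀ d, (∃ i, g.vert d = g.vert (c i)) → (∃ j, g.vert (g.dinv d) = g.vert (c j)) →
    ∃ i, d = c i ∨ d = g.dinv (c i)

/-- The girth: the least length of a cycle. -/
noncomputable def girth (g : CubicGraph n) : ℕ :=
  sInf {k | 0 < k ∧ ∃ c : Fin k → Fin (6 * n), g.IsCycle k c}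

/-- The only cycles of the graph are loops. -/
def OnlyLoopCycles (g : CubicGraph n) : Prop :=
  ∀ k, 2 ≤ k → ∀ c : Fin k → Fin (6 * n), ¬ g.IsCycle k c

/-- The number of darts lying on loops (each loop contributes two darts). -/
def loopCount (g : CubicGraph n) : ℕ :=
  (Finset.univ.filter fun d => g.IsLoop d).card

end CubicGraph

instance {n : ℕ} : Finite (CubicGraph n) := by
  have hinj : Function.Injective fun g : CubicGraph n => (g.vert, g.dinv) := by
    rintro ⟨v₁, i₁, _, _, _⟩ ⟨v₂, i₂, _, _, _⟩ h
    simp only [Prod.mk.injEq] at h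
    obtain ⟨h₁, h₂⟩ := h
    subst h₁; subst h₂; rfl
  exact Finite.of_injective _ hinj

/-- Isomorphism of connected cubic graphs. -/
def cgIso {n : ℕ} (g₁ g₂ : {g : CubicGraph n // g.Connected}) : Prop :=
  CubicGraph.IsIsomorphic g₁.1 g₂.1

/-- The vertex set of the graph of graphs `Γ_n`: isomorphism classes of connected cubic
multigraphs on `2 * n` vertices. -/
abbrev GammaV (n : ℕ) := Quot (@cgIso n)

/-- The number of directed edges of `Γ_n` from the class `u` to the class `v`: one edge for
each Whitehead move of a representative of `u` whose result lies in the class `v`.  A move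
specification is a pair `(i, x)` of a move type `i : Fin 2` and a dart `x`; each of the two
Whitehead moves of each edge is counted by exactly two specifications (one for each of the
two darts of the edge), whence the division by `2`. -/
noncomputable def edgeMult (n : ℕ) (u v : GammaV n) : ℕ :=
  Nat.card {p : Fin 2 × Fin (6 * n) //
    CubicGraph.IsIsomorphic ((Quot.out u).1.wh p.1 p.2) (Quot.out v).1} / 2

/-- The sum of out-degrees of the classes in `S` (every class has out-degree `6 * n`:
two Whitehead moves for each of the `3 * n` edges). -/
noncomputable def dOut (n : ℕ) (S : Set (GammaV n)) : ℕ :=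
  Nat.card {q : GammaV n × Fin 2 × Fin (6 * n) // q.1 ∈ S} / 2

/-- The number of directed edges of `Γ_n` from `S` to its complement. -/
noncomputable def boundaryCount (n : ℕ) (S : Set (GammaV n)) : ℕ :=
  Nat.card {q : GammaV n × Fin 2 × Fin (6 * n) // q.1 ∈ S ∧
    ∀ v : GammaV n,
      CubicGraph.IsIsomorphic ((Quot.out q.1).1.wh q.2.1 q.2.2) (Quot.out v).1 → v ∉ S} / 2

/-- The outer conductance of a set `S` of vertices of `Γ_n`. -/
noncomputable def phiOutSet (n : ℕ) (S : Set (GammaV n)) : ℝ :=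
  (boundaryCount n S : ℝ) / min (dOut n S : ℝ) (dOut n Sᶜ : ℝ)

/-- The outer conductance of `Γ_n`: the infimum of the outer conductances of nonempty
proper subsets of vertices. -/
noncomputable def phiOut (n : ℕ) : ℝ :=
  sInf {x : ℝ | ∃ S : Set (GammaV n), S.Nonempty ∧ Sᶜ.Nonempty ∧ x = phiOutSet n S}

/-- The set of classes of bridged cubic graphs. -/
def bridgedSet (n : ℕ) : Set (GammaV n) := {u | (Quot.out u).1.Bridged}

namespace CubicGraph

variable {n : ℕ}

lemma mem_othersAt {g : CubicGraph n} {x y : Fin (6 * n)} :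
    y ∈ g.othersAt x ↔ y ≠ x ∧ g.vert y = g.vert x := by
  simp [othersAt]

lemma card_othersAt (g : CubicGraph n) (x : Fin (6 * n)) : (g.othersAt x).card = 2 := by
  rw [othersAt, Finset.card_erase_of_mem (by simp), g.regular]

lemma oMin_ne_oMax (g : CubicGraph n) (x : Fin (6 * n)) : g.oMin x ≠ g.oMax x :=
  (Finset.min'_lt_max'_of_card _ (by rw [card_othersAt]; norm_num)).ne

lemma oMin_mem (g : CubicGraph n) (x : Fin (6 * n)) : g.oMin x ∈ g.othersAt x :=
  Finset.min'_mem _ _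

lemma oMax_mem (g : CubicGraph n) (x : Fin (6 * n)) : g.oMax x ∈ g.othersAt x :=
  Finset.max'_mem _ _

lemma othersAt_eq (g : CubicGraph n) (x : Fin (6 * n)) :
    g.othersAt x = {g.oMin x, g.oMax x} := by
  symm
  apply Finset.eq_of_subset_of_card_le
  · intro y hy
    rcases Finset.mem_insert.1 hy with rfl | hy
    · exact g.oMin_mem x
    · rw [Finset.mem_singleton.1 hy]
      exact g.oMax_mem x
  · rw [card_othersAt, Finset.card_pair (g.oMin_ne_oMax x)]

lemma eq_oMin_or_eq_oMax {g : CubicGraph n} {x y : Fin (6 * n)} (hne : y ≠ x)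
    (hv : g.vert y = g.vert x) : y = g.oMin x ∨ y = g.oMax x := by
  have h : y ∈ g.othersAt x := mem_othersAt.2 ⟨hne, hv⟩
  simpa [othersAt_eq] using h

lemma wh_dinv (g : CubicGraph n) (i : Fin 2) (x : Fin (6 * n)) : (g.wh i x).dinv = g.dinv := by
  unfold wh
  split_ifs <;> rfl

/-- A Whitehead move only changes the base vertices of darts at the ends of the edge. -/
lemma wh_vert_of_ne (g : CubicGraph n) (i : Fin 2) (x d : Fin (6 * n))
    (hu : g.vert d ≠ g.vert x) (hv : g.vert d ≠ g.vert (g.dinv x)) :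
    (g.wh i x).vert d = g.vert d := by
  have h₁ : d ≠ g.oMax x := fun h => hu (h ▸ (mem_othersAt.1 (g.oMax_mem x)).2)
  have h₂ : d ≠ g.oMax (g.dinv x) := fun h => hv (h ▸ (mem_othersAt.1 (g.oMax_mem _)).2)
  have h₃ : d ≠ g.oMin (g.dinv x) := fun h => hv (h ▸ (mem_othersAt.1 (g.oMin_mem _)).2)
  unfold wh
  split_ifs
  · rfl
  · simp [swapDarts, Equiv.swap_apply_of_ne_of_ne h₁ h₃]
  · simp [swapDarts, Equiv.swap_apply_of_ne_of_ne h₁ h₂]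

/-- One of the two Whitehead moves on a non-loop edge pairs two prescribed darts at its two
different ends. -/
lemma exists_wh_vert_eq {g : CubicGraph n} {x a c : Fin (6 * n)} (hx : ¬ g.IsLoop x)
    (ha : a ≠ x) (hav : g.vert a = g.vert x) (hc : c ≠ g.dinv x)
    (hcv : g.vert c = g.vert (g.dinv x)) :
    ∃ i, (g.wh i x).vert a = (g.wh i x).vert c ∧
      ((g.wh i x).vert c = g.vert x ∨ (g.wh i x).vert c = g.vert (g.dinv x)) := by
  have hne : g.vert (g.dinv x) ≠ g.vert x := hx
  have hmin := (mem_othersAt.1 (g.oMin_mem x)).2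
  have hmin' := (mem_othersAt.1 (g.oMin_mem (g.dinv x))).2
  have hmax := (mem_othersAt.1 (g.oMax_mem x)).2
  have hmax' := (mem_othersAt.1 (g.oMax_mem (g.dinv x))).2
  have hmm := g.oMin_ne_oMax x
  have hmm' := g.oMin_ne_oMax (g.dinv x)
  rcases eq_oMin_or_eq_oMax ha hav with ha | ha <;>
    rcases eq_oMin_or_eq_oMax hc hcv with hc | hc
  · refine ⟨0, ?_⟩
    simp only [wh, hx, swapDarts, Equiv.swap_apply_def]
    grind
  · refine ⟨1, ?_⟩
    simp only [wh, hx, swapDarts, Equiv.swap_apply_def]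
    grind
  · refine ⟨1, ?_⟩
    simp only [wh, hx, swapDarts, Equiv.swap_apply_def]
    grind
  · refine ⟨0, ?_⟩
    simp only [wh, hx, swapDarts, Equiv.swap_apply_def]
    grind

/-- A suitable Whitehead move on an edge of a cycle of length at least two shortens it by one. -/
lemma IsCycle.exists_wh {g : CubicGraph n} {k : ℕ} {c : Fin (k + 2) → Fin (6 * n)}
    (hc : g.IsCycle (k + 2) c) :
    ∃ (i : Fin 2) (x : Fin (6 * n)) (c' : Fin (k + 1) → Fin (6 * n)),
      (g.wh i x).IsCycle (k + 1) c' := by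
  obtain ⟨hstep, hinj, hdinv⟩ := hc
  have hfirst : g.vert (g.dinv (c 0)) = g.vert (c 1) := hstep 0
  have hlast : g.vert (g.dinv (c (Fin.last (k + 1)))) = g.vert (c 0) := by
    rw [hstep]
    congr 2
    ext
    simp
  have hx : ¬ g.IsLoop (c 0) := fun h => by
    have := hinj (hfirst.symm.trans h)
    simp at this
  obtain ⟨i, hpair, hend⟩ := exists_wh_vert_eq hx
    (fun h => hdinv (Fin.last (k + 1)) 0 h.symm) hlast (hdinv 0 1) hfirst.symm
  have hsame : ∀ (d : Fin (6 * n)) (j : Fin (k + 2)), g.vert d = g.vert (c j) → j ≠ 0 → j ≠ 1 →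
      (g.wh i (c 0)).vert d = g.vert (c j) := by
    intro d j hd h0 h1
    rw [wh_vert_of_ne, hd]
    · rw [hd]
      exact fun h => h0 (hinj h)
    · rw [hd, hfirst]
      exact fun h => h1 (hinj h)
  have hfar : ∀ j : Fin (k + 2), j ≠ 0 → j ≠ 1 →
      (g.wh i (c 0)).vert (c j) ≠ (g.wh i (c 0)).vert (c 1) := by
    intro j h0 h1 h
    rw [hsame _ j rfl h0 h1] at h
    rcases hend with he | he
    · exact h0 (hinj (h.trans he))
    · exact h1 (hinj (h.trans (he.trans hfirst)))
  refine ⟨i, c 0, fun j => c j.succ, ?_, ?_, ?_⟩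
  · intro j
    rw [wh_dinv]
    rcases Fin.eq_castSucc_or_eq_last j with ⟨t, rfl⟩ | rfl
    · have hlt : t.1 + 2 < k + 2 := by omega
      have h := hstep t.castSucc.succ
      have e : (⟨(t.castSucc.succ.1 + 1) % (k + 2), Nat.mod_lt _ t.castSucc.succ.pos⟩ :
          Fin (k + 2)) = t.succ.succ := by
        ext
        simp [Nat.mod_eq_of_lt hlt]
      have e' : (⟨(t.castSucc.1 + 1) % (k + 1), Nat.mod_lt _ t.castSucc.pos⟩ :
          Fin (k + 1)) = t.succ := by
        ext
        simp
      have h0 : t.succ.succ ≠ 0 := Fin.succ_ne_zero _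
      have h1 : t.succ.succ ≠ 1 := by simp [Fin.ext_iff]
      rw [e] at h
      rw [e', hsame _ _ h h0 h1, hsame _ _ rfl h0 h1]
    · have e : (⟨((Fin.last k).1 + 1) % (k + 1), Nat.mod_lt _ (Fin.last k).pos⟩ :
          Fin (k + 1)) = 0 := by
        ext
        simp
      rw [e]
      exact hpair
  · intro a b hab
    by_contra hne
    have key : ∀ s t : Fin (k + 1), s ≠ t →
        (g.wh i (c 0)).vert (c s.succ) = (g.wh i (c 0)).vert (c t.succ) → s ≠ 0 := by
      rintro s t hst h rfl
      refine hfar t.succ (Fin.succ_ne_zero _) (fun ht => hst ?_) h.symm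
      exact (Fin.succ_injective _ (ht.trans Fin.succ_zero_eq_one.symm)).symm
    have ha := key a b hne hab
    have hb := key b a (Ne.symm hne) hab.symm
    have aux : ∀ s : Fin (k + 1), s ≠ 0 → s.succ ≠ 1 := fun s hs h =>
      hs (Fin.succ_injective _ (h.trans Fin.succ_zero_eq_one.symm))
    simp only [hsame _ _ rfl (Fin.succ_ne_zero a) (aux a ha),
      hsame _ _ rfl (Fin.succ_ne_zero b) (aux b hb)] at hab
    exact hne (Fin.succ_injective _ (hinj hab))
  · intro a b
    rw [wh_dinv]
    exact hdinv _ _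

/-- A cycle of length `k + 1` can be shrunk to a loop by `k` Whitehead moves. -/
lemma IsCycle.exists_moves_isLoop {k : ℕ} {g : CubicGraph n} {c : Fin (k + 1) → Fin (6 * n)}
    (hc : g.IsCycle (k + 1) c) :
    ∃ gs : ℕ → CubicGraph n, gs 0 = g ∧
      (∀ j, j < k → ∃ (i : Fin 2) (x : Fin (6 * n)), gs (j + 1) = (gs j).wh i x) ∧
      ∃ d, (gs k).IsLoop d := by
  induction k generalizing g with
  | zero => exact ⟨fun _ => g, rfl, by simp, c 0, hc.1 0⟩
  | succ k ih =>
    obtain ⟨i, x, c', hc'⟩ := hc.exists_wh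
    obtain ⟨gs, h0, hmove, hloop⟩ := ih hc'
    refine ⟨fun j => Nat.casesOn j g gs, rfl, ?_, hloop⟩
    rintro (_ | j) hj
    · exact ⟨i, x, h0⟩
    · exact hmove j (by omega)

/-- The edge at the vertex of a loop other than the loop is a bridge. -/
lemma IsLoop.bridged {g : CubicGraph n} {d : Fin (6 * n)} (hd : g.IsLoop d) : g.Bridged := by
  have hdv : g.vert (g.dinv d) = g.vert d := hd
  obtain ⟨f, hf⟩ : ∃ f, (g.othersAt d).erase (g.dinv d) = {f} := by
    rw [← Finset.card_eq_one, Finset.card_erase_of_mem (mem_othersAt.2 ⟨g.dinv_ne d, hd⟩),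
      card_othersAt]
  have hmem : ∀ y, g.vert y = g.vert d → y = d ∨ y = g.dinv d ∨ y = f := by
    intro y hy
    by_contra! h
    have hy' : y ∈ (g.othersAt d).erase (g.dinv d) :=
      Finset.mem_erase.2 ⟨h.2.1, mem_othersAt.2 ⟨h.1, hy⟩⟩
    rw [hf] at hy'
    exact h.2.2 (Finset.mem_singleton.1 hy')
  have hclosed : ∀ y, g.ReachAvoiding f d y → g.vert y = g.vert d := by
    intro y hy
    induction hy with
    | refl => rfl
    | @tail a b _ hab ih =>
      rcases hab with hab | ⟨rfl, hne, -⟩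
      · rw [← hab, ih]
      · rcases hmem a ih with rfl | rfl | rfl
        · exact hd
        · rw [g.dinv_invol]
        · exact absurd rfl hne
  refine ⟨f, fun h => ?_⟩
  have hcard := g.regular (g.vert d)
  rw [Finset.filter_true_of_mem fun y _ => hclosed y (h d y), Finset.card_univ,
    Fintype.card_fin] at hcard
  omega

/-- Every nonempty cubic graph contains a cycle. -/
lemma exists_isCycle (g : CubicGraph n) (hn : 1 ≤ n) :
    ∃ k, 0 < k ∧ ∃ c : Fin k → Fin (6 * n), g.IsCycle k c := by
  classical
  let s : ℕ → Fin (6 * n) := fun t => (fun d => g.oMin (g.dinv d))^[t] ⟨0, by omega⟩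
  have hs : ∀ t, s (t + 1) = g.oMin (g.dinv (s t)) := fun t =>
    Function.iterate_succ_apply' _ _ _
  have hv : ∀ t, g.vert (g.dinv (s t)) = g.vert (s (t + 1)) := fun t => by
    rw [hs]
    exact (mem_othersAt.1 (g.oMin_mem _)).2.symm
  have hne : ∀ t, s (t + 1) ≠ g.dinv (s t) := fun t => by
    rw [hs]
    exact (mem_othersAt.1 (g.oMin_mem _)).1
  have hex : ∃ k, 0 < k ∧ ∃ i, g.vert (s i) = g.vert (s (i + k)) := by
    obtain ⟨a, b, hab, h⟩ := Finite.exists_ne_map_eq_of_infinite fun t => g.vert (s t)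
    rcases lt_or_gt_of_ne hab with hlt | hlt
    · exact ⟨b - a, by omega, a, by rw [Nat.add_sub_cancel' hlt.le]; exact h⟩
    · exact ⟨a - b, by omega, b, by rw [Nat.add_sub_cancel' hlt.le]; exact h.symm⟩
  obtain ⟨k, ⟨hk, i, hi⟩, hmin⟩ : ∃ k, (0 < k ∧ ∃ i, g.vert (s i) = g.vert (s (i + k))) ∧
      ∀ l, 0 < l → (∃ i, g.vert (s i) = g.vert (s (i + l))) → k ≤ l :=
    ⟨Nat.find hex, Nat.find_spec hex, fun l hl h => Nat.find_min' hex ⟨hl, h⟩⟩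
  have hinj : ∀ a b, a < k → b < k → g.vert (s (i + a)) = g.vert (s (i + b)) → a = b := by
    have aux : ∀ a b, b < k → a < b → g.vert (s (i + a)) ≠ g.vert (s (i + b)) := by
      intro a b hb hab h
      have := hmin (b - a) (by omega) ⟨i + a, by rw [h]; congr 2; omega⟩
      omega
    intro a b ha hb h
    rcases lt_trichotomy a b with hab | hab | hab
    · exact absurd h (aux a b hb hab)
    · exact hab
    · exact absurd h.symm (aux b a ha hab)
  have hnext : ∀ a, a < k → g.vert (g.dinv (s (i + a))) = g.vert (s (i + (a + 1) % k)) := by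
    intro a ha
    rw [hv]
    rcases Nat.lt_or_ge (a + 1) k with h | h
    · rw [Nat.mod_eq_of_lt h, Nat.add_assoc]
    · obtain rfl : k = a + 1 := by omega
      rw [Nat.mod_self, Nat.add_assoc, ← hi, Nat.add_zero]
  refine ⟨k, hk, fun t => s (i + t), fun t => hnext t t.2,
    fun a b h => Fin.ext (hinj a b a.2 b.2 h), ?_⟩
  rintro ⟨a, ha⟩ ⟨b, hb⟩ (h : s (i + b) = g.dinv (s (i + a)))
  have h' : s (i + a) = g.dinv (s (i + b)) := by rw [h, g.dinv_invol]
  have hba : b = (a + 1) % k :=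
    hinj _ _ hb (Nat.mod_lt _ hk) (by rw [h, hnext a ha])
  have hab : a = (b + 1) % k :=
    hinj _ _ ha (Nat.mod_lt _ hk) (by rw [h', hnext b hb])
  rcases Nat.lt_or_ge (a + 1) k with hlt | hge
  · rw [Nat.mod_eq_of_lt hlt] at hba
    subst hba
    exact hne (i + a) h
  · obtain rfl : k = a + 1 := by omega
    rw [Nat.mod_self] at hba
    subst hba
    rcases Nat.eq_zero_or_pos a with rfl | hpos
    · exact g.dinv_ne _ h.symm
    · obtain rfl : a = 1 := by rw [hab, Nat.mod_eq_of_lt (by omega)]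
      exact hne i h'

end CubicGraph

/-- Every connected cubic graph `g` on `2n` vertices can be transformed by at
most `girth g - 1` Whitehead moves into a cubic graph containing a loop, and hence (when `g`
has more than two vertices) into a bridged graph. -/
theorem loop_within_girth_moves (n : ℕ) (hn : 1 ≤ n) (g : CubicGraph n) (hg : g.Connected) :
    ∃ (m : ℕ) (gs : ℕ → CubicGraph n), m ≤ g.girth - 1 ∧ gs 0 = g ∧
      (∀ j, j < m → ∃ (i : Fin 2) (x : Fin (6 * n)), gs (j + 1) = (gs j).wh i x) ∧
      (∃ d, (gs m).IsLoop d) ∧ (2 ≤ n → (gs m).Bridged) := by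
  have hmem := Nat.sInf_mem (g.exists_isCycle hn)
  obtain ⟨hpos, hcycle⟩ : 0 < g.girth ∧ ∃ c, g.IsCycle g.girth c := hmem
  obtain ⟨k, hk⟩ : ∃ k, g.girth = k + 1 := ⟨g.girth - 1, by omega⟩
  rw [hk] at hcycle ⊢
  obtain ⟨c, hc⟩ := hcycle
  obtain ⟨gs, h0, hmove, d, hd⟩ := hc.exists_moves_isLoop
  exact ⟨k, gs, by omega, h0, hmove, ⟨d, hd⟩, fun _ => hd.bridged⟩
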